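/- Let p ≥ 5 be a prime and let r, s be positive integers. Then M(2^r·p^s) = 9 if s = 1 and either p = 2^r + 1 or p = 2^r − 1; M(2^r·p^s) = 7 if s ≥ 2 and either p = 2^r + 1 or p = 2^r − 1; M(2^r·p^s) = 7 if s = 1 and either p is a Fermat prime with p ≠ 2^r + 1 or p is a Mersenne prime with p ≠ 2^r − 1; and M(2^r·p^s) = 5 otherwise. -/

import Mathlib

/-- A pair of integers `(a, b)` is multiplicatively dependent: `ab ≠ 0` and
there is a nonzero pair of integer exponents `(k₁, k₂)` with `a^k₁ * b^k₂ = 1`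
(evaluated in `ℚ`). -/
def MultDepPair (a b : ℤ) : Prop :=
  a * b ≠ 0 ∧ ∃ k : ℤ × ℤ, k ≠ 0 ∧ (a : ℚ) ^ k.1 * (b : ℚ) ^ k.2 = 1

/-- `MSet d` is the set of multiplicatively dependent pairs `(a, b) ∈ ℤ²`
with difference `b - a = d`. -/
def MSet (d : ℤ) : Set (ℤ × ℤ) :=
  {p | MultDepPair p.1 p.2 ∧ p.2 - p.1 = d}

/-- `M d` is the number of multiplicatively dependent pairs with difference `d`. -/
noncomputable def M (d : ℤ) : ℕ := (MSet d).ncard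

/-- `g` is a perfect power: `g = a ^ k` with `a ≥ 2`, `k ≥ 2`. -/
def IsPerfectPow (g : ℕ) : Prop := ∃ a k : ℕ, 2 ≤ a ∧ 2 ≤ k ∧ g = a ^ k

/-- `Nplus d` is the number of primitive solutions `(g, x, y)` of `g^y + g^x = d`
with `g ≥ 2` not a perfect power and `y > x ≥ 1`. -/
noncomputable def Nplus (d : ℕ) : ℕ :=
  {T : ℕ × ℕ × ℕ | 2 ≤ T.1 ∧ 1 ≤ T.2.1 ∧ T.2.1 < T.2.2 ∧ ¬ IsPerfectPow T.1 ∧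
    T.1 ^ T.2.2 + T.1 ^ T.2.1 = d}.ncard

/-- `Nminus d` is the number of primitive solutions `(g, x, y)` of `g^y - g^x = d`
with `g ≥ 2` not a perfect power and `y > x ≥ 1`. -/
noncomputable def Nminus (d : ℕ) : ℕ :=
  {T : ℕ × ℕ × ℕ | 2 ≤ T.1 ∧ 1 ≤ T.2.1 ∧ T.2.1 < T.2.2 ∧ ¬ IsPerfectPow T.1 ∧
    T.1 ^ T.2.2 = T.1 ^ T.2.1 + d}.ncard

/-- A Fermat prime: a prime of the form `2^m + 1` with `m ≥ 1`. -/
def FermatPrime (p : ℕ) : Prop := p.Prime ∧ ∃ m : ℕ, 1 ≤ m ∧ p = 2 ^ m + 1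

/-- A Mersenne prime: a prime of the form `2^m - 1` with `m ≥ 1`. -/
def MersennePrime (p : ℕ) : Prop := p.Prime ∧ ∃ m : ℕ, 1 ≤ m ∧ p + 1 = 2 ^ m

theorem multDepPair_iff (a b : ℤ) :
    MultDepPair a b ↔ a ≠ 0 ∧ b ≠ 0 ∧
      ∃ m n : ℕ, (m ≠ 0 ∨ n ≠ 0) ∧ a.natAbs ^ m = b.natAbs ^ n := by
  unfold MultDepPair
  rw [mul_ne_zero_iff, and_assoc]
  refine and_congr_right fun ha => and_congr_right fun hb => ⟨?_, ?_⟩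
  · rintro ⟨⟨k, l⟩, hk, h⟩
    refine ⟨k.natAbs, l.natAbs, ?_, ?_⟩
    · by_contra! h0
      exact hk (by simpa using h0)
    have hA : (0 : ℚ) < (a.natAbs : ℚ) := by exact_mod_cast Int.natAbs_pos.2 ha
    have hB : (0 : ℚ) < (b.natAbs : ℚ) := by exact_mod_cast Int.natAbs_pos.2 hb
    have h' : (a.natAbs : ℚ) ^ k * (b.natAbs : ℚ) ^ l = 1 := by
      have := congrArg abs h
      rw [abs_mul, abs_zpow, abs_zpow, abs_one] at this
      simpa [Nat.cast_natAbs] using this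
    generalize a.natAbs = A at *
    generalize b.natAbs = B at *
    have mul_case : ∀ m n : ℕ, A ^ m * B ^ n = 1 → A ^ m = B ^ n := fun m n h1 => by
      rw [Nat.eq_one_of_mul_eq_one_right h1, Nat.eq_one_of_mul_eq_one_left h1]
    obtain ⟨m, rfl | rfl⟩ := k.eq_nat_or_neg <;> obtain ⟨n, rfl | rfl⟩ := l.eq_nat_or_neg <;>
      simp only [Int.natAbs_neg, Int.natAbs_natCast, zpow_neg, zpow_natCast] at h' ⊢
    · exact mul_case m n (by exact_mod_cast h')
    · exact_mod_cast (mul_inv_eq_one₀ (by positivity)).1 h'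
    · exact_mod_cast ((inv_mul_eq_one₀ (by positivity)).1 h')
    · rw [← mul_inv, inv_eq_one] at h'
      exact mul_case m n (by exact_mod_cast h')
  · rintro ⟨m, n, hmn, h⟩
    refine ⟨(2 * m, -(2 * n)), ?_, ?_⟩
    · simp only [ne_eq, Prod.mk_eq_zero]
      omega
    have hb' : (b : ℚ) ≠ 0 := by exact_mod_cast hb
    have h2 : (a : ℚ) ^ (2 * m) = (b : ℚ) ^ (2 * n) := by
      have : a ^ (2 * m) = b ^ (2 * n) := by
        rw [pow_mul, pow_mul, ← Int.natAbs_sq a, ← Int.natAbs_sq b, pow_right_comm,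
          pow_right_comm (b.natAbs : ℤ)]
        exact_mod_cast congrArg (· ^ 2) h
      exact_mod_cast this
    dsimp only
    rw [zpow_neg, mul_inv_eq_one₀ (zpow_ne_zero _ hb')]
    exact_mod_cast h2

theorem Int.odd_geom_sum_iff {q : ℤ} (hq : Odd q) (s : ℕ) :
    Odd (∑ i ∈ Finset.range s, q ^ i) ↔ Odd s := by
  induction s with
  | zero => simp
  | succ s ih =>
    have : ¬ Even (q ^ s) := Int.not_even_iff_odd.2 hq.pow
    rw [Finset.sum_range_succ, Int.odd_add, ih, Nat.odd_add_one]
    tauto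

theorem Nat.eq_one_of_odd_of_dvd_two_pow {t j : ℕ} (ht : Odd t) (h : t ∣ 2 ^ j) : t = 1 :=
  Nat.Coprime.eq_one_of_dvd (ht.coprime_two_right.pow_right j) h

theorem exponent_eq_one_of_pow_eq_two_pow_add_one {p s j : ℕ} (hp : Odd p) (hp5 : 5 ≤ p)
    (h : p ^ s = 2 ^ j + 1) : s = 1 := by
  have hs0 : s ≠ 0 := by
    rintro rfl
    simp at h
  rcases Nat.even_or_odd s with ⟨t, rfl⟩ | hs
  · have h1 : (p ^ t + 1) * (p ^ t - 1) = 2 ^ j := by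
      rw [← Nat.sq_sub_sq, one_pow, ← pow_mul, mul_two, h, Nat.add_sub_cancel]
    obtain ⟨u, -, hu⟩ := (Nat.dvd_prime_pow Nat.prime_two).1 (Dvd.intro _ h1)
    obtain ⟨v, -, hv⟩ := (Nat.dvd_prime_pow Nat.prime_two).1 (Dvd.intro_left _ h1)
    have h5 : 5 ≤ p ^ t := hp5.trans (Nat.le_self_pow (by omega) p)
    have hu2 : 2 < u := by
      by_contra! hc
      have : 2 ^ u ≤ 2 ^ 2 := Nat.pow_le_pow_right (by norm_num) hc
      omega
    have hv2 : 2 ≤ v := by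
      by_contra! hc
      have : 2 ^ v ≤ 2 ^ 1 := Nat.pow_le_pow_right (by norm_num) (by omega)
      omega
    have d1 : 2 ^ 2 ∣ 2 ^ u := pow_dvd_pow 2 hu2.le
    have d2 : 2 ^ 2 ∣ 2 ^ v := pow_dvd_pow 2 hv2
    omega
  · have h1 := Nat.geomSum_eq (m := p) (by omega) s
    have h2 : (∑ i ∈ Finset.range s, p ^ i) * (p - 1) = 2 ^ j := by
      have := geom_sum_mul_add (p - 1) s
      rw [Nat.sub_add_cancel (by omega)] at this
      omega
    have h3 := Nat.eq_one_of_odd_of_dvd_two_pow ((Finset.odd_sum_iff_odd_card_odd _).2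
      (by simpa [hp.pow] using hs)) (Dvd.intro _ h2)
    rw [h3, one_mul] at h2
    have h4 : p ^ s = p ^ 1 := by
      rw [pow_one]
      omega
    exact Nat.pow_right_injective (by omega) h4

theorem exponent_eq_one_of_pow_add_one_eq_two_pow {p s j : ℕ} (hp : Odd p) (hp5 : 5 ≤ p)
    (hs0 : s ≠ 0) (h : p ^ s + 1 = 2 ^ j) : s = 1 := by
  have h5 : 5 ≤ p ^ s := hp5.trans (Nat.le_self_pow hs0 p)
  rcases Nat.even_or_odd s with ⟨t, rfl⟩ | hs
  · have hj : 2 ≤ j := by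
      by_contra! hc
      have : 2 ^ j ≤ 2 ^ 1 := Nat.pow_le_pow_right (by norm_num) (by omega)
      omega
    have d : 2 ^ 2 ∣ 2 ^ j := pow_dvd_pow 2 hj
    obtain ⟨w, hw⟩ := (hp.pow (n := t))
    rw [← h, pow_add, hw] at d
    ring_nf at d
    omega
  · have h1 := geom_sum_mul (-(p : ℤ)) s
    rw [hs.neg_pow] at h1
    have h2 : (∑ i ∈ Finset.range s, (-(p : ℤ)) ^ i) * (p + 1) = 2 ^ j := by
      have : (p : ℤ) ^ s + 1 = 2 ^ j := by exact_mod_cast h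
      linarith
    have hodd : Odd (∑ i ∈ Finset.range s, (-(p : ℤ)) ^ i).natAbs := by
      rw [Int.natAbs_odd, Int.odd_geom_sum_iff (by simpa using hp)]
      exact hs
    have h2' := congrArg Int.natAbs h2
    rw [Int.natAbs_mul, Int.natAbs_pow] at h2'
    have h3 := Nat.eq_one_of_odd_of_dvd_two_pow hodd (Dvd.intro _ h2')
    rw [h3, one_mul] at h2'
    have h4 : p ^ s = p ^ 1 := by
      have : ((p : ℤ) + 1).natAbs = p + 1 := by omega
      rw [this] at h2'
      change p + 1 = 2 ^ j at h2'
      rw [pow_one]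
      omega
    exact Nat.pow_right_injective (by omega) h4

theorem eq_prime_pow_of_pow_eq {q A C i m n : ℕ} (hq : q.Prime) (hn : n ≠ 0) (hA : A = q ^ i)
    (h : A ^ m = C ^ n) : ∃ j, C = q ^ j := by
  have : C ∣ q ^ (i * m) := by
    rw [pow_mul, ← hA, h]
    exact dvd_pow_self C hn
  obtain ⟨j, -, hj⟩ := (Nat.dvd_prime_pow hq).1 this
  exact ⟨j, hj⟩

/-- The coprime factorisations `A * E = 2 ^ r * p ^ s` where `A` has a power in common with `C`. -/
theorem split_two_pow_mul_prime_pow {p r s A C E m n : ℕ} (hp : p.Prime) (hp5 : 5 ≤ p)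
    (hA : 2 ≤ A) (hm : m ≠ 0) (hn : n ≠ 0)
    (hAC : A ^ m = C ^ n) (hCE : C.Coprime E) (hE : E = 1 → C = 2) (h : A * E = 2 ^ r * p ^ s) :
    (A = 2 ^ r ∧ E = p ^ s ∧ ∃ j, C = 2 ^ j) ∨ (A = p ^ s ∧ E = 2 ^ r ∧ ∃ j, C = p ^ j) := by
  have hAE : A.Coprime E := by
    rw [← Nat.coprime_pow_left_iff (Nat.pos_of_ne_zero hm), hAC]
    exact hCE.pow_left n
  have hdvd : ∀ q : ℕ, q.Prime → q ∣ A → q ∣ C := fun q hq hqA =>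
    hq.dvd_of_dvd_pow (hAC ▸ dvd_pow hqA hm)
  have cop : ∀ q k : ℕ, q.Prime → ¬ q ∣ A → A.Coprime (q ^ k) := fun q k hq hqA =>
    (((Nat.Prime.coprime_iff_not_dvd hq).2 hqA).symm).pow_right k
  have copE : ∀ q k : ℕ, q.Prime → q ∣ A → (q ^ k).Coprime E := fun q k hq hqA =>
    (Nat.Coprime.of_dvd_left hqA hAE).pow_left k
  have h2 := Nat.prime_two
  by_cases d2 : 2 ∣ A <;> by_cases dp : p ∣ A
  · exfalso
    have hE1 : E = 1 := ((copE 2 r h2 d2).mul_left (copE p s hp dp)).symm.eq_one_of_dvd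
      (Dvd.intro_left _ h)
    have := hdvd p hp dp
    rw [hE hE1] at this
    exact absurd (Nat.le_of_dvd two_pos this) (by omega)
  · left
    have e : A = 2 ^ r := Nat.dvd_antisymm
      ((cop p s hp dp).dvd_of_dvd_mul_right (Dvd.intro _ h))
      ((copE 2 r h2 d2).dvd_of_dvd_mul_right (h ▸ Dvd.intro _ rfl))
    refine ⟨e, ?_, eq_prime_pow_of_pow_eq h2 hn e hAC⟩
    rw [e] at h
    exact Nat.eq_of_mul_eq_mul_left (by positivity) h
  · right
    have e : A = p ^ s := Nat.dvd_antisymm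
      ((cop 2 r h2 d2).dvd_of_dvd_mul_left (Dvd.intro _ h))
      ((copE p s hp dp).dvd_of_dvd_mul_right (h ▸ Dvd.intro_left _ rfl))
    refine ⟨e, ?_, eq_prime_pow_of_pow_eq hp hn e hAC⟩
    rw [e, mul_comm] at h
    exact Nat.eq_of_mul_eq_mul_right (pow_pos hp.pos s) h
  · have := ((cop 2 r h2 d2).mul_right (cop p s hp dp)).eq_one_of_dvd (Dvd.intro _ h)
    omega

theorem exists_eq_mul_of_pow_eq {A B m n : ℕ} (hA : 2 ≤ A) (hAB : A < B)
    (hmn : m ≠ 0 ∨ n ≠ 0) (h : A ^ m = B ^ n) :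
    ∃ C k, 2 ≤ C ∧ k ≠ 0 ∧ n ≠ 0 ∧ B = A * C ∧ A ^ k = C ^ n := by
  have hn : n ≠ 0 := by
    rintro rfl
    rw [pow_zero, Nat.pow_eq_one] at h
    omega
  have hlt : n < m := by
    by_contra! hc
    have h1 : A ^ m ≤ A ^ n := Nat.pow_le_pow_right (by omega) hc
    have h2 : A ^ n < B ^ n := Nat.pow_lt_pow_left hAB hn
    omega
  obtain ⟨k, rfl⟩ := Nat.exists_eq_add_of_lt hlt
  obtain ⟨C, rfl⟩ : A ∣ B := (Nat.pow_dvd_pow_iff hn).1 (h ▸ pow_dvd_pow A hlt.le)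
  refine ⟨C, k + 1, ?_, by omega, hn, rfl, ?_⟩
  · by_contra! hc
    interval_cases C <;> omega
  · rw [add_assoc, pow_add, mul_pow] at h
    exact Nat.eq_of_mul_eq_mul_left (by positivity) h

theorem classify_add {p r s A B m n : ℕ} (hp : p.Prime) (hp5 : 5 ≤ p) (hA : 2 ≤ A)
    (hAB : A < B) (hmn : m ≠ 0 ∨ n ≠ 0) (h : A ^ m = B ^ n) (hD : B + A = 2 ^ r * p ^ s) :
    (A = 2 ^ r ∧ s = 1 ∧ FermatPrime p) ∨ (A = p ^ s ∧ p + 1 = 2 ^ r) := by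
  have hodd : Odd p := hp.odd_of_ne_two (by omega)
  obtain ⟨C, k, hC, hk, hn, rfl, hAC⟩ := exists_eq_mul_of_pow_eq hA hAB hmn h
  rcases split_two_pow_mul_prime_pow hp hp5 hA hk hn hAC (E := C + 1) (by simp) (by omega)
    (by rw [← hD]; ring) with ⟨h1, h2, j, rfl⟩ | ⟨h1, h2, j, rfl⟩
  · have hs := exponent_eq_one_of_pow_eq_two_pow_add_one hodd hp5 h2.symm
    subst hs
    refine Or.inl ⟨h1, rfl, hp, j, ?_, by simpa using h2.symm⟩
    by_contra! hj
    interval_cases j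
    exact absurd hC (by norm_num)
  · have hj : j ≠ 0 := by
      rintro rfl
      exact absurd hC (by norm_num)
    have := exponent_eq_one_of_pow_add_one_eq_two_pow hodd hp5 hj h2
    subst this
    exact Or.inr ⟨h1, by simpa using h2⟩

theorem classify_sub {p r s A B m n : ℕ} (hp : p.Prime) (hp5 : 5 ≤ p) (hs : 1 ≤ s) (hA : 2 ≤ A)
    (hAB : A < B) (hmn : m ≠ 0 ∨ n ≠ 0) (h : A ^ m = B ^ n) (hD : B = A + 2 ^ r * p ^ s) :
    (A = 2 ^ r ∧ s = 1 ∧ MersennePrime p) ∨ (A = p ^ s ∧ p = 2 ^ r + 1) := by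
  have hodd : Odd p := hp.odd_of_ne_two (by omega)
  obtain ⟨C, k, hC, hk, hn, rfl, hAC⟩ := exists_eq_mul_of_pow_eq hA hAB hmn h
  obtain ⟨E, rfl⟩ : ∃ E, C = E + 1 := ⟨C - 1, by omega⟩
  rcases split_two_pow_mul_prime_pow hp hp5 hA hk hn hAC (E := E) (by simp) (by omega)
    (by linarith) with ⟨h1, rfl, j, h2⟩ | ⟨h1, rfl, j, h2⟩
  · have hs := exponent_eq_one_of_pow_add_one_eq_two_pow hodd hp5 (by omega) h2
    subst hs
    refine Or.inl ⟨h1, rfl, hp, j, ?_, by simpa using h2⟩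
    by_contra! hj
    interval_cases j
    simp at h2
    omega
  · have := exponent_eq_one_of_pow_eq_two_pow_add_one hodd hp5 h2.symm
    subst this
    exact Or.inr ⟨h1, by simpa using h2.symm⟩

theorem multDepPair_of_natAbs_eq_pow {a b : ℤ} {q i k : ℕ} (hq : q ≠ 0) (hi : i ≠ 0)
    (ha : a.natAbs = q ^ i) (hb : b.natAbs = q ^ k) : MultDepPair a b := by
  rw [multDepPair_iff]
  refine ⟨?_, ?_, k, i, Or.inr hi, ?_⟩
  · rw [← Int.natAbs_ne_zero, ha]
    exact pow_ne_zero i hq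
  · rw [← Int.natAbs_ne_zero, hb]
    exact pow_ne_zero k hq
  · rw [ha, hb, pow_right_comm]

theorem multDepPair_neg_swap {a b : ℤ} (h : MultDepPair a b) : MultDepPair (-b) (-a) := by
  rw [multDepPair_iff] at h ⊢
  obtain ⟨ha, hb, m, n, hmn, h⟩ := h
  exact ⟨by simpa using hb, by simpa using ha, n, m, hmn.symm, by simpa using h.symm⟩

theorem M_eq_ncard (D : ℤ) : M D = {a : ℤ | MultDepPair a (a + D)}.ncard := by
  have : MSet D = (fun a : ℤ => (a, a + D)) '' {a : ℤ | MultDepPair a (a + D)} := by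
    ext ⟨a, b⟩
    simp only [MSet, Set.mem_ofPred_eq, Set.mem_image, Prod.mk.injEq]
    constructor
    · rintro ⟨h, hd⟩
      obtain rfl : b = a + D := by omega
      exact ⟨a, h, rfl, rfl⟩
    · rintro ⟨_, h, rfl, rfl⟩
      exact ⟨h, by omega⟩
  rw [M, this, Set.ncard_image_of_injective]
  intro a a' h
  exact congrArg Prod.fst h

theorem two_mul_lt_two_pow_mul_prime_pow {p r s : ℕ} (hp5 : 5 ≤ p) (hs : 1 ≤ s) :
    2 * 2 ^ r < 2 ^ r * p ^ s ∧ 5 ≤ p ^ s := by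
  have h5 : 5 ≤ p ^ s := hp5.trans (Nat.le_self_pow (by omega) p)
  have : 0 < 2 ^ r := by positivity
  exact ⟨by nlinarith, h5⟩

theorem multDepPair_two_pow_mul_prime_pow_iff {p r s : ℕ} (hp : p.Prime) (hp5 : 5 ≤ p)
    (hr : 1 ≤ r) (hs : 1 ≤ s) {D e : ℤ} (hD : D = (2 ^ r * p ^ s : ℕ)) (he : D = 2 * e) (a : ℤ) :
    MultDepPair a (a + D) ↔
      a = -e ∨ (a = 1 ∨ a = -1 - D) ∨ (a = -1 ∨ a = 1 - D) ∨
      ((s = 1 ∧ FermatPrime p) ∧ (a = -2 ^ r ∨ a = 2 ^ r - D)) ∨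
      ((s = 1 ∧ MersennePrime p) ∧ (a = 2 ^ r ∨ a = -2 ^ r - D)) ∨
      (p + 1 = 2 ^ r ∧ (a = -p ^ s ∨ a = p ^ s - D)) ∨
      (p = 2 ^ r + 1 ∧ (a = p ^ s ∨ a = -p ^ s - D)) := by
  obtain ⟨hX, hY⟩ := two_mul_lt_two_pow_mul_prime_pow (r := r) hp5 hs
  have hX0 : 0 < 2 ^ r := by positivity
  have hXc : (2 : ℤ) ^ r = ((2 ^ r : ℕ) : ℤ) := by push_cast; rfl
  have hYc : (p : ℤ) ^ s = ((p ^ s : ℕ) : ℤ) := by push_cast; rfl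
  constructor
  · rw [multDepPair_iff]
    rintro ⟨ha, hb, m, n, hmn, h⟩
    by_cases ha1 : a.natAbs = 1
    · rcases Int.natAbs_eq_iff.1 ha1 with h1 | h1
      · exact Or.inr (Or.inl (Or.inl h1))
      · exact Or.inr (Or.inr (Or.inl (Or.inl h1)))
    by_cases hb1 : (a + D).natAbs = 1
    · rcases Int.natAbs_eq_iff.1 hb1 with h1 | h1
      · exact Or.inr (Or.inr (Or.inl (Or.inr (eq_sub_of_add_eq h1))))
      · exact Or.inr (Or.inl (Or.inr (eq_sub_of_add_eq h1)))
    rw [hXc, hYc]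
    rcases lt_trichotomy a.natAbs (a + D).natAbs with hlt | heq | hlt
    · by_cases hpos : 0 < a
      · rcases classify_sub hp hp5 (r := r) hs (by omega) hlt hmn h (by omega) with
          ⟨h1, h2⟩ | ⟨h1, h2⟩
        · exact Or.inr (Or.inr (Or.inr (Or.inr (Or.inl ⟨h2, by omega⟩))))
        · exact Or.inr (Or.inr (Or.inr (Or.inr (Or.inr (Or.inr ⟨h2, by omega⟩)))))
      · rcases classify_add hp hp5 (r := r) (s := s) (by omega) hlt hmn h (by omega) with
          ⟨h1, h2⟩ | ⟨h1, h2⟩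
        · exact Or.inr (Or.inr (Or.inr (Or.inl ⟨h2, by omega⟩)))
        · exact Or.inr (Or.inr (Or.inr (Or.inr (Or.inr (Or.inl ⟨h2, by omega⟩)))))
    · exact Or.inl (by omega)
    · by_cases hneg : a + D < 0
      · rcases classify_sub hp hp5 (r := r) hs (by omega) hlt hmn.symm h.symm (by omega) with
          ⟨h1, h2⟩ | ⟨h1, h2⟩
        · exact Or.inr (Or.inr (Or.inr (Or.inr (Or.inl ⟨h2, by omega⟩))))
        · exact Or.inr (Or.inr (Or.inr (Or.inr (Or.inr (Or.inr ⟨h2, by omega⟩)))))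
      · rcases classify_add hp hp5 (r := r) (s := s) (by omega) hlt hmn.symm h.symm (by omega) with
          ⟨h1, h2⟩ | ⟨h1, h2⟩
        · exact Or.inr (Or.inr (Or.inr (Or.inl ⟨h2, by omega⟩)))
        · exact Or.inr (Or.inr (Or.inr (Or.inr (Or.inr (Or.inl ⟨h2, by omega⟩)))))
  · have key : ∀ c c' : ℤ, c' = -c → MultDepPair c (c + D) → a = c ∨ a = c' - D →
        MultDepPair a (a + D) := by
      rintro c c' rfl h (rfl | rfl)
      · exact h
      · have := multDepPair_neg_swap h
        rwa [neg_add', ← sub_add_cancel (-c) D, add_sub_cancel_right] at this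
    have unit : ∀ c : ℤ, c.natAbs = 1 → c + D ≠ 0 → MultDepPair c (c + D) := fun c hc hcD =>
      (multDepPair_iff _ _).2 ⟨by omega, hcD, 1, 0, Or.inl one_ne_zero, by simpa using hc⟩
    have hDc : D = 2 ^ r * p ^ s := by
      rw [hD]
      push_cast
      rfl
    rintro (h | h | h | ⟨⟨rfl, -, j, -, hj⟩, h⟩ | ⟨⟨rfl, -, j, -, hj⟩, h⟩ | ⟨hj, h⟩ | ⟨hj, h⟩)
    · exact (multDepPair_iff _ _).2 ⟨by omega, by omega, 1, 1, Or.inl one_ne_zero, by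
        rw [show (a + D).natAbs = a.natAbs by omega]⟩
    · exact key 1 (-1) rfl (unit 1 rfl (by omega)) h
    · exact key (-1) 1 rfl (unit (-1) rfl (by omega)) h
    · refine key (-2 ^ r) (2 ^ r) (by ring) (multDepPair_of_natAbs_eq_pow (q := 2) (i := r)
        (k := r + j) two_ne_zero (by omega) (by simp [Int.natAbs_pow]) ?_) h
      rw [hDc, hj, show -(2 : ℤ) ^ r + 2 ^ r * ((2 ^ j + 1 : ℕ) : ℤ) ^ 1 = 2 ^ (r + j) by
        push_cast; ring]
      simp [Int.natAbs_pow]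
    · refine key (2 ^ r) (-2 ^ r) (by ring) (multDepPair_of_natAbs_eq_pow (q := 2) (i := r)
        (k := r + j) two_ne_zero (by omega) (by simp [Int.natAbs_pow]) ?_) h
      have hj' : (p : ℤ) + 1 = 2 ^ j := by exact_mod_cast hj
      rw [hDc, show (2 : ℤ) ^ r + 2 ^ r * (p : ℤ) ^ 1 = 2 ^ (r + j) by
        rw [pow_add, ← hj']; ring]
      simp [Int.natAbs_pow]
    · refine key (-p ^ s) (p ^ s) (by ring) (multDepPair_of_natAbs_eq_pow (q := p) (i := s)
        (k := s + 1) hp.ne_zero (by omega) (by simp [Int.natAbs_pow]) ?_) h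
      have hj' : (p : ℤ) + 1 = 2 ^ r := by exact_mod_cast hj
      rw [hDc, show -(p : ℤ) ^ s + 2 ^ r * (p : ℤ) ^ s = p ^ (s + 1) by
        rw [← hj']; ring]
      simp [Int.natAbs_pow]
    · refine key (p ^ s) (-p ^ s) (by ring) (multDepPair_of_natAbs_eq_pow (q := p) (i := s)
        (k := s + 1) hp.ne_zero (by omega) (by simp [Int.natAbs_pow]) ?_) h
      have hj' : (p : ℤ) = 2 ^ r + 1 := by exact_mod_cast hj
      rw [hDc, show (p : ℤ) ^ s + 2 ^ r * (p : ℤ) ^ s = p ^ (s + 1) by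
        rw [pow_succ]; nth_rw 4 [hj']; ring]
      simp [Int.natAbs_pow]

theorem ncard_trivial {D e : ℤ} (he : D = 2 * e) (h5 : 2 ≤ e) {S : Set ℤ}
    (hS : ∀ a, a ∈ S ↔ a = -e ∨ (a = 1 ∨ a = -1 - D) ∨ (a = -1 ∨ a = 1 - D)) :
    S.ncard = 5 := by
  have : S = (({-e, 1, -1 - D, -1, 1 - D} : Finset ℤ) : Set ℤ) := by
    ext a
    simp [hS, or_assoc]
  rw [this, Set.ncard_coe_finset]
  repeat rw [Finset.card_insert_of_notMem (by
    simp only [Finset.mem_insert, Finset.mem_singleton]; omega)]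
  rfl

theorem ncard_one_family {D e c c' : ℤ} (he : D = 2 * e) (hc' : c' = -c) (h2 : 2 ≤ c.natAbs)
    (hc : (c.natAbs : ℤ) < e) {S : Set ℤ}
    (hS : ∀ a, a ∈ S ↔ a = -e ∨ (a = 1 ∨ a = -1 - D) ∨ (a = -1 ∨ a = 1 - D) ∨
      (a = c ∨ a = c' - D)) : S.ncard = 7 := by
  have : S = (({-e, 1, -1 - D, -1, 1 - D, c, c' - D} : Finset ℤ) : Set ℤ) := by
    ext a
    simp [hS, or_assoc]
  rw [this, Set.ncard_coe_finset]
  repeat rw [Finset.card_insert_of_notMem (by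
    simp only [Finset.mem_insert, Finset.mem_singleton]; omega)]
  rfl

theorem ncard_two_families {D e c c' d d' : ℤ} (he : D = 2 * e) (hc' : c' = -c) (hd' : d' = -d)
    (hc2 : 2 ≤ c.natAbs) (hc : (c.natAbs : ℤ) < e) (hd2 : 2 ≤ d.natAbs)
    (hd : (d.natAbs : ℤ) < e) (hcd : c.natAbs ≠ d.natAbs) {S : Set ℤ}
    (hS : ∀ a, a ∈ S ↔ a = -e ∨ (a = 1 ∨ a = -1 - D) ∨ (a = -1 ∨ a = 1 - D) ∨
      (a = c ∨ a = c' - D) ∨ (a = d ∨ a = d' - D)) : S.ncard = 9 := by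
  have : S = (({-e, 1, -1 - D, -1, 1 - D, c, c' - D, d, d' - D} : Finset ℤ) : Set ℤ) := by
    ext a
    simp [hS, or_assoc]
  rw [this, Set.ncard_coe_finset]
  repeat rw [Finset.card_insert_of_notMem (by
    simp only [Finset.mem_insert, Finset.mem_singleton]; omega)]
  rfl

theorem FermatPrime.not_mersennePrime {p : ℕ} (hp5 : 5 ≤ p) (hF : FermatPrime p) :
    ¬ MersennePrime p := by
  rintro ⟨-, k, -, hk⟩
  obtain ⟨-, j, -, hj⟩ := hF
  have hj2 : 2 ≤ j := by
    by_contra! hc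
    have : 2 ^ j ≤ 2 ^ 1 := Nat.pow_le_pow_right (by norm_num) (by omega)
    omega
  have hk2 : 2 ≤ k := by
    by_contra! hc
    have : 2 ^ k ≤ 2 ^ 1 := Nat.pow_le_pow_right (by norm_num) (by omega)
    omega
  have d1 : 2 ^ 2 ∣ 2 ^ j := pow_dvd_pow 2 hj2
  have d2 : 2 ^ 2 ∣ 2 ^ k := pow_dvd_pow 2 hk2
  omega

theorem stmt8 (p r s : ℕ) (hp : p.Prime) (hp5 : 5 ≤ p) (hr : 1 ≤ r) (hs : 1 ≤ s) :
    (s = 1 ∧ (p = 2 ^ r + 1 ∨ p + 1 = 2 ^ r) →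
      M ((2 ^ r * p ^ s : ℕ) : ℤ) = 9) ∧
    (2 ≤ s ∧ (p = 2 ^ r + 1 ∨ p + 1 = 2 ^ r) →
      M ((2 ^ r * p ^ s : ℕ) : ℤ) = 7) ∧
    (s = 1 ∧ ((FermatPrime p ∧ p ≠ 2 ^ r + 1) ∨ (MersennePrime p ∧ p + 1 ≠ 2 ^ r)) →
      M ((2 ^ r * p ^ s : ℕ) : ℤ) = 7) ∧
    (¬(s = 1 ∧ (p = 2 ^ r + 1 ∨ p + 1 = 2 ^ r)) ∧
     ¬(2 ≤ s ∧ (p = 2 ^ r + 1 ∨ p + 1 = 2 ^ r)) ∧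
     ¬(s = 1 ∧ ((FermatPrime p ∧ p ≠ 2 ^ r + 1) ∨ (MersennePrime p ∧ p + 1 ≠ 2 ^ r))) →
      M ((2 ^ r * p ^ s : ℕ) : ℤ) = 5) := by
  obtain ⟨hX, hY⟩ := two_mul_lt_two_pow_mul_prime_pow (r := r) hp5 hs
  have hX2 : 2 ≤ 2 ^ r := Nat.le_self_pow (by omega) 2
  have hXc : (2 : ℤ) ^ r = ((2 ^ r : ℕ) : ℤ) := by push_cast; rfl
  have hYc : (p : ℤ) ^ s = ((p ^ s : ℕ) : ℤ) := by push_cast; rfl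
  have hYD : 4 ≤ 2 ^ r → 2 * p ^ s < 2 ^ r * p ^ s := fun h => by nlinarith
  have hXY : 2 ^ r ≠ p ^ s := fun h => by
    have h2 : Odd (p ^ s) := (hp.odd_of_ne_two (by omega)).pow
    rw [← h, Nat.odd_pow_iff (by omega)] at h2
    exact absurd h2 (by decide)
  have hF1 : p = 2 ^ r + 1 → FermatPrime p := fun h => ⟨hp, r, hr, h⟩
  have hM1 : p + 1 = 2 ^ r → MersennePrime p := fun h => ⟨hp, r, hr, h⟩
  have hFM := FermatPrime.not_mersennePrime hp5
  obtain ⟨e, he⟩ : ∃ e : ℤ, ((2 ^ r * p ^ s : ℕ) : ℤ) = 2 * e := by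
    obtain ⟨t, rfl⟩ := Nat.exists_eq_add_of_le' hr
    exact ⟨2 ^ t * p ^ s, by push_cast; ring⟩
  have hS := multDepPair_two_pow_mul_prime_pow_iff hp hp5 hr hs rfl he
  rw [M_eq_ncard]
  refine ⟨?_, ?_, ?_, ?_⟩
  · rintro ⟨h1, h | h⟩
    · have hF := hF1 h
      have hsF := eq_true (And.intro h1 hF)
      have hsM : ¬ (s = 1 ∧ MersennePrime p) := fun hM => hFM hF hM.2
      refine ncard_two_families (c := -2 ^ r) (c' := 2 ^ r) (d := p ^ s) (d' := -p ^ s) he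
        (by omega) (by omega) (by omega) (by omega) (by omega) (by omega) (by omega) fun a => ?_
      have h' : p + 1 ≠ 2 ^ r := by omega
      simp only [Set.mem_ofPred_eq, hS, hsF, hsM, eq_true h, h', true_and, false_and, false_or]
    · have hM := hM1 h
      have hsF : ¬ (s = 1 ∧ FermatPrime p) := fun hF => hFM hF.2 hM
      have hsM := eq_true (And.intro h1 hM)
      refine ncard_two_families (c := 2 ^ r) (c' := -2 ^ r) (d := -p ^ s) (d' := p ^ s) he
        (by omega) (by omega) (by omega) (by omega) (by omega) (by omega) (by omega) fun a => ?_
      have h' : p ≠ 2 ^ r + 1 := by omega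
      simp only [Set.mem_ofPred_eq, hS, hsF, hsM, eq_true h, h', true_and, false_and, false_or,
        or_false]
  · rintro ⟨h1, h | h⟩
    · refine ncard_one_family (c := p ^ s) (c' := -p ^ s) he
        (by omega) (by omega) (by omega) fun a => ?_
      have h' : p + 1 ≠ 2 ^ r := by omega
      have h1' : s ≠ 1 := by omega
      simp only [Set.mem_ofPred_eq, hS, h1', eq_true h, h', true_and, false_and, false_or]
    · refine ncard_one_family (c := -p ^ s) (c' := p ^ s) he
        (by omega) (by omega) (by omega) fun a => ?_
      have h' : p ≠ 2 ^ r + 1 := by omega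
      have h1' : s ≠ 1 := by omega
      simp only [Set.mem_ofPred_eq, hS, h1', eq_true h, h', true_and, false_and, false_or,
        or_false]
  · rintro ⟨h1, ⟨hF, h⟩ | ⟨hM, h⟩⟩
    · have hsF := eq_true (And.intro h1 hF)
      have hsM : ¬ (s = 1 ∧ MersennePrime p) := fun hM => hFM hF hM.2
      have h' : p + 1 ≠ 2 ^ r := fun h' => hFM hF (hM1 h')
      refine ncard_one_family (c := -2 ^ r) (c' := 2 ^ r) he
        (by omega) (by omega) (by omega) fun a => ?_
      simp only [Set.mem_ofPred_eq, hS, hsF, hsM, h, h', true_and, false_and,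
        or_false]
    · have hsF : ¬ (s = 1 ∧ FermatPrime p) := fun hF => hFM hF.2 hM
      have hsM := eq_true (And.intro h1 hM)
      have h' : p ≠ 2 ^ r + 1 := fun h' => hFM (hF1 h') hM
      refine ncard_one_family (c := 2 ^ r) (c' := -2 ^ r) he
        (by omega) (by omega) (by omega) fun a => ?_
      simp only [Set.mem_ofPred_eq, hS, hsF, hsM, h, h', true_and, false_and,
        false_or, or_false]
  · rintro ⟨h1, h2, h3⟩
    refine ncard_trivial he (by omega) fun a => ?_
    have hP1 : p ≠ 2 ^ r + 1 := by omega
    have hP2 : p + 1 ≠ 2 ^ r := by omega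
    have hsF : ¬ (s = 1 ∧ FermatPrime p) := fun hF => h3 ⟨hF.1, Or.inl ⟨hF.2, hP1⟩⟩
    have hsM : ¬ (s = 1 ∧ MersennePrime p) := fun hM => h3 ⟨hM.1, Or.inr ⟨hM.2, hP2⟩⟩
    simp only [Set.mem_ofPred_eq, hS, hsF, hsM, hP1, hP2, false_and, or_false]
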